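/- arXiv:2202.01118 — 5 statements merged into one kernel-verified Lean document; each statement's English description precedes it below -/
import Mathlib

section
/- Let μ be a data-generating distribution on ℝⁿ that is linearly separable by a hyperplane (w₀,b₀) ∈ ℝⁿ × ℝ, and assume its support X is bounded. Let Q ∈ ℝ^{m×n} be η-inner-product-preserving over X with η < 1/‖w₀‖². Then μ remains linearly separable under the compression of Q: there exist w' ∈ ℝᵐ and b' ∈ ℝ such that ⟨w',Qx⟩ + b' ≥ 1 for μ⁺-almost every x and ⟨w',Qx⟩ + b' ≤ −1 for μ⁻-almost every x. -/
open MeasureTheory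
open scoped RealInnerProductSpace

/-- The support of a Borel measure: points every open neighborhood of which has
positive measure. -/
def measSupport {n : ℕ} (ν : Measure (EuclideanSpace ℝ (Fin n))) :
    Set (EuclideanSpace ℝ (Fin n)) :=
  {x | ∀ U : Set (EuclideanSpace ℝ (Fin n)), IsOpen U → x ∈ U → 0 < ν U}

section Separation

variable {E F : Type*} [NormedAddCommGroup E] [InnerProductSpace ℝ E]
  [NormedAddCommGroup F] [InnerProductSpace ℝ F]

/-- A nonempty closed convex set contains a point `u` with `‖u‖ ^ 2 ≤ ⟪u, d⟫` on the whole set. -/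
theorem exists_mem_forall_norm_sq_le_inner [CompleteSpace E] {K : Set E} (hne : K.Nonempty)
    (hconv : Convex ℝ K) (hclosed : IsClosed K) : ∃ u ∈ K, ∀ d ∈ K, ‖u‖ ^ 2 ≤ ⟪u, d⟫ := by
  obtain ⟨u, hu, h⟩ := exists_norm_eq_iInf_of_complete_convex hne hclosed.isComplete hconv 0
  refine ⟨u, hu, fun d hd => ?_⟩
  have := (norm_eq_iInf_iff_real_inner_le_zero hconv hu).1 h d hd
  rw [zero_sub, inner_neg_left, inner_sub_right, real_inner_self_eq_norm_sq] at this
  linarith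

/-- An upper bound on `⟪u, d⟫ - ⟪Q u, Q d⟫` over `u ∈ D` extends to the closed convex hull of `D`. -/
theorem inner_sub_inner_map_le_of_mem_closedConvexHull [FiniteDimensional ℝ E] (Q : E →ₗ[ℝ] F)
    {D : Set E} {d : E} {c : ℝ} (h : ∀ u ∈ D, ⟪u, d⟫ - ⟪Q u, Q d⟫ ≤ c) {u : E}
    (hu : u ∈ closedConvexHull ℝ D) : ⟪u, d⟫ - ⟪Q u, Q d⟫ ≤ c := by
  have hQ : Continuous Q := Q.continuous_of_finiteDimensional
  have hlin : IsLinearMap ℝ fun u : E => ⟪u, d⟫ - ⟪Q u, Q d⟫ :=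
    ⟨fun x y => by simp only [map_add, inner_add_left]; ring,
      fun a x => by simp only [map_smul, real_inner_smul_left, smul_eq_mul]; ring⟩
  exact closedConvexHull_min (t := {u | ⟪u, d⟫ - ⟪Q u, Q d⟫ ≤ c}) h
    (convex_halfSpace_le hlin c) (isClosed_le (by fun_prop) continuous_const) hu

/-- Two nonempty sets on which a function differs by at least `δ > 0` can be separated at levels
`1` and `-1` after an affine rescaling of the function. -/
theorem exists_affine_separation {α : Type*} {A B : Set α} (hA : A.Nonempty) (hB : B.Nonempty)
    {s : α → ℝ} {δ : ℝ} (hδ : 0 < δ) (h : ∀ x ∈ A, ∀ y ∈ B, δ ≤ s x - s y) :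
    ∃ c b : ℝ, (∀ x ∈ A, 1 ≤ c * s x + b) ∧ ∀ y ∈ B, c * s y + b ≤ -1 := by
  obtain ⟨y₀, hy₀⟩ := hB
  have hbdd : BddBelow (s '' A) :=
    ⟨s y₀ + δ, Set.forall_mem_image.2 fun x hx => by linarith [h x hx y₀ hy₀]⟩
  refine ⟨2 / δ, 1 - 2 / δ * sInf (s '' A), fun x hx => ?_, fun y hy => ?_⟩
  · have := mul_le_mul_of_nonneg_left (csInf_le hbdd (Set.mem_image_of_mem s hx))
      (by positivity : 0 ≤ 2 / δ)
    linarith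
  · have hle : s y + δ ≤ sInf (s '' A) :=
      le_csInf (hA.image s) (Set.forall_mem_image.2 fun x hx => by linarith [h x hx y hy])
    have := mul_le_mul_of_nonneg_left hle (by positivity : 0 ≤ 2 / δ)
    rw [mul_add, div_mul_cancel₀ _ hδ.ne'] at this
    linarith

/-- An almost inner-product-preserving linear map keeps two separated sets separated. -/
theorem exists_separation_map [FiniteDimensional ℝ E] {A B : Set E} (hA : A.Nonempty)
    (hB : B.Nonempty) {w₀ : E} {b₀ : ℝ} (hwA : ∀ x ∈ A, 1 ≤ ⟪w₀, x⟫ + b₀)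
    (hwB : ∀ x ∈ B, ⟪w₀, x⟫ + b₀ ≤ -1) (Q : E →ₗ[ℝ] F) {η : ℝ}
    (hQ : ∀ x ∈ A ∪ B, ∀ y ∈ A ∪ B, |⟪Q x, Q y⟫ - ⟪x, y⟫| ≤ η) (hη : η < 1 / ‖w₀‖ ^ 2) :
    ∃ (w : F) (b : ℝ), (∀ x ∈ A, 1 ≤ ⟪w, Q x⟫ + b) ∧ ∀ x ∈ B, ⟪w, Q x⟫ + b ≤ -1 := by
  have : CompleteSpace E := FiniteDimensional.complete ℝ E
  set D : Set E := Set.image2 (· - ·) A B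
  set K : Set E := closedConvexHull ℝ D
  have hDK : D ⊆ K := subset_closedConvexHull
  have hmargin : ∀ d ∈ K, 2 ≤ ⟪w₀, d⟫ := by
    refine closedConvexHull_min (t := {d | 2 ≤ ⟪w₀, d⟫}) ?_
      (convex_halfSpace_ge ⟨fun x y => inner_add_right _ _ _,
        fun a x => real_inner_smul_right _ _ _⟩ 2)
      (isClosed_le continuous_const (by fun_prop))
    rintro _ ⟨x, hx, y, hy, rfl⟩
    simp only [Set.mem_ofPred_eq, inner_sub_right]
    linarith [hwA x hx, hwB y hy]
  obtain ⟨u, huK, hu⟩ := exists_mem_forall_norm_sq_le_inner (hA.image2 hB |>.mono hDK)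
    (convex_closedConvexHull (𝕜 := ℝ)) isClosed_closedConvexHull
  have hdist : ∀ d ∈ D, ∀ v ∈ D, ⟪v, d⟫ - ⟪Q v, Q d⟫ ≤ 4 * η := by
    rintro _ ⟨x, hx, y, hy, rfl⟩ _ ⟨x', hx', y', hy', rfl⟩
    simp only [map_sub, inner_sub_left, inner_sub_right]
    have h₁ := abs_le.1 (hQ x' (.inl hx') x (.inl hx))
    have h₂ := abs_le.1 (hQ x' (.inl hx') y (.inr hy))
    have h₃ := abs_le.1 (hQ y' (.inr hy') x (.inl hx))
    have h₄ := abs_le.1 (hQ y' (.inr hy') y (.inr hy))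
    linarith [h₁.1, h₂.2, h₃.2, h₄.1]
  have hδ : 0 < ‖u‖ ^ 2 - 4 * η := by
    have hwu : 2 ≤ ‖w₀‖ * ‖u‖ := (hmargin u huK).trans (real_inner_le_norm _ _)
    have hw : 0 < ‖w₀‖ := by
      by_contra hw
      nlinarith [norm_nonneg u]
    rw [lt_div_iff₀ (by positivity)] at hη
    by_contra! hle
    have hsq : 4 ≤ (‖w₀‖ * ‖u‖) ^ 2 := by nlinarith
    nlinarith [mul_le_mul_of_nonneg_left hle (sq_nonneg ‖w₀‖)]
  obtain ⟨c, b, hcA, hcB⟩ := exists_affine_separation hA hB (s := fun x => ⟪Q u, Q x⟫) hδ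
    fun x hx y hy => by
      have hd : x - y ∈ D := ⟨x, hx, y, hy, rfl⟩
      rw [← inner_sub_right, ← map_sub]
      linarith [hu _ (hDK hd), inner_sub_inner_map_le_of_mem_closedConvexHull Q (hdist _ hd) huK]
  exact ⟨c • Q u, b, by simpa only [real_inner_smul_left] using hcA,
    by simpa only [real_inner_smul_left] using hcB⟩

end Separation

theorem measSupport_eq_support {n : ℕ} (ν : Measure (EuclideanSpace ℝ (Fin n))) :
    measSupport ν = ν.support := by
  ext x
  rw [Measure.mem_support_iff_forall]
  refine ⟨fun h U hU => ?_, fun h U hU hx => h U (hU.mem_nhds hx)⟩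
  exact (h _ isOpen_interior (mem_interior_iff_mem_nhds.2 hU)).trans_le
    (measure_mono interior_subset)

theorem stmt_0 {n m : ℕ}
    (μp μm : Measure (EuclideanSpace ℝ (Fin n)))
    [IsProbabilityMeasure μp] [IsProbabilityMeasure μm]
    (w₀ : EuclideanSpace ℝ (Fin n)) (b₀ : ℝ)
    (hsepP : ∀ᵐ x ∂μp, ⟪w₀, x⟫ + b₀ ≥ 1)
    (hsepM : ∀ᵐ x ∂μm, ⟪w₀, x⟫ + b₀ ≤ -1)
    (X : Set (EuclideanSpace ℝ (Fin n)))
    (hX : X = measSupport μp ∪ measSupport μm)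
    (hbdd : Bornology.IsBounded X)
    (Q : EuclideanSpace ℝ (Fin n) →ₗ[ℝ] EuclideanSpace ℝ (Fin m))
    (η : ℝ)
    (hQ : ∀ x ∈ X, ∀ x' ∈ X, |⟪Q x, Q x'⟫ - ⟪x, x'⟫| ≤ η)
    (hη : η < 1 / ‖w₀‖ ^ 2) :
    ∃ (w' : EuclideanSpace ℝ (Fin m)) (b' : ℝ),
      (∀ᵐ x ∂μp, ⟪w', Q x⟫ + b' ≥ 1) ∧
      (∀ᵐ x ∂μm, ⟪w', Q x⟫ + b' ≤ -1) := by
  rw [measSupport_eq_support, measSupport_eq_support] at hX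
  subst hX
  obtain ⟨w, b, hp, hm⟩ := exists_separation_map
    (Measure.nonempty_support (IsProbabilityMeasure.ne_zero μp))
    (Measure.nonempty_support (IsProbabilityMeasure.ne_zero μm))
    (Measure.support_subset_of_isClosed
      (isClosed_le continuous_const (by fun_prop : Continuous fun x => ⟪w₀, x⟫ + b₀)) hsepP)
    (Measure.support_subset_of_isClosed
      (isClosed_le (by fun_prop : Continuous fun x => ⟪w₀, x⟫ + b₀) continuous_const) hsepM)
    Q hQ hη
  exact ⟨w, b, Filter.mem_of_superset Measure.support_mem_ae hp,
    Filter.mem_of_superset Measure.support_mem_ae hm⟩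
end

section
/- Let μ be a data-generating distribution on ℝⁿ that is linearly separable by a hyperplane (w₀,b₀) ∈ ℝⁿ × ℝ. Let x̄' ∈ cl(co(X⁺)) and x̄'' ∈ cl(co(X⁻)) satisfy ‖x̄' − x̄''‖ = δ, where δ := inf{‖x' − x''‖ : x' ∈ co(X⁺), x'' ∈ co(X⁻)}, and let w* := 2(x̄' − x̄'')/‖x̄' − x̄''‖². Then ‖w*‖ ≤ ‖w₀‖. -/
open MeasureTheory
open scoped RealInnerProductSpace

/-- A closed set of full measure contains the support. -/
theorem measSupport_subset_of_ae_mem {n : ℕ} {ν : Measure (EuclideanSpace ℝ (Fin n))}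
    {C : Set (EuclideanSpace ℝ (Fin n))} (hC : IsClosed C) (h : ∀ᵐ x ∂ν, x ∈ C) :
    measSupport ν ⊆ C := by
  intro x hx
  by_contra hxC
  exact (hx Cᶜ hC.isOpen_compl hxC).ne' (mem_ae_iff.mp h)

/-- A closed convex set of full measure contains the closed convex hull of the support. -/
theorem closure_convexHull_measSupport_subset {n : ℕ}
    {ν : Measure (EuclideanSpace ℝ (Fin n))} {C : Set (EuclideanSpace ℝ (Fin n))}
    (hC : IsClosed C) (hconv : Convex ℝ C) (h : ∀ᵐ x ∂ν, x ∈ C) :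
    closure (convexHull ℝ (measSupport ν)) ⊆ C :=
  closure_minimal (convexHull_min (measSupport_subset_of_ae_mem hC h) hconv) hC

/-- If `w` separates along `v` with gap at least `2`, then `(2 / ‖v‖ ^ 2) • v` is no longer
than `w`. -/
theorem norm_two_div_sq_smul_le {E : Type*} [NormedAddCommGroup E] [InnerProductSpace ℝ E]
    {w v : E} (h : 2 ≤ ⟪w, v⟫) : ‖(2 / ‖v‖ ^ 2) • v‖ ≤ ‖w‖ := by
  have hle : 2 ≤ ‖w‖ * ‖v‖ := h.trans (real_inner_le_norm w v)
  have hv : 0 < ‖v‖ := by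
    by_contra! hv
    nlinarith [norm_nonneg w]
  have hnorm : ‖(2 / ‖v‖ ^ 2) • v‖ = 2 / ‖v‖ := by
    rw [norm_smul, Real.norm_of_nonneg (by positivity)]
    field_simp
  rwa [hnorm, div_le_iff₀ hv]

theorem stmt_11 {n : ℕ}
    (μp μm : Measure (EuclideanSpace ℝ (Fin n)))
    [IsProbabilityMeasure μp] [IsProbabilityMeasure μm]
    (w₀ : EuclideanSpace ℝ (Fin n)) (b₀ : ℝ)
    (hsepP : ∀ᵐ x ∂μp, ⟪w₀, x⟫ + b₀ ≥ 1)
    (hsepM : ∀ᵐ x ∂μm, ⟪w₀, x⟫ + b₀ ≤ -1)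
    (δ : ℝ)
    (hδ : δ = sInf {d : ℝ | ∃ x' ∈ convexHull ℝ (measSupport μp),
      ∃ x'' ∈ convexHull ℝ (measSupport μm), d = ‖x' - x''‖})
    (xb' xb'' : EuclideanSpace ℝ (Fin n))
    (hxb' : xb' ∈ closure (convexHull ℝ (measSupport μp)))
    (hxb'' : xb'' ∈ closure (convexHull ℝ (measSupport μm)))
    (hdist : ‖xb' - xb''‖ = δ)
    (wstar : EuclideanSpace ℝ (Fin n))
    (hw : wstar = (2 / ‖xb' - xb''‖ ^ 2) • (xb' - xb'')) :
    ‖wstar‖ ≤ ‖w₀‖ := by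
  have hlin : IsLinearMap ℝ fun x : EuclideanSpace ℝ (Fin n) => ⟪w₀, x⟫ :=
    (innerₛₗ ℝ w₀).isLinear
  have hP : 1 - b₀ ≤ ⟪w₀, xb'⟫ := by
    refine closure_convexHull_measSupport_subset (C := {x | 1 - b₀ ≤ ⟪w₀, x⟫})
      (isClosed_le (by fun_prop) (by fun_prop)) (convex_halfSpace_ge hlin _) ?_ hxb'
    filter_upwards [hsepP] with x hx
    exact sub_le_iff_le_add.mpr hx
  have hM : ⟪w₀, xb''⟫ ≤ -1 - b₀ := by
    refine closure_convexHull_measSupport_subset (C := {x | ⟪w₀, x⟫ ≤ -1 - b₀})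
      (isClosed_le (by fun_prop) (by fun_prop)) (convex_halfSpace_le hlin _) ?_ hxb''
    filter_upwards [hsepM] with x hx
    exact le_sub_iff_add_le.mpr hx
  rw [hw]
  apply norm_two_div_sq_smul_le
  rw [inner_sub_right]
  linarith
end

section
/- Let X⁺ and X⁻ be nonempty subsets of ℝⁿ with δ := inf{‖x' − x''‖ : x' ∈ co(X⁺), x'' ∈ co(X⁻)} > 0, and let x̄' ∈ cl(co(X⁺)) and x̄'' ∈ cl(co(X⁻)) satisfy ‖x̄' − x̄''‖ = δ. Define w* := 2(x̄' − x̄'')/‖x̄' − x̄''‖² and b* := 1 − 2⟨x̄' − x̄'', x̄'⟩/‖x̄' − x̄''‖². Then ⟨w*,x⟩ + b* ≥ 1 for every x ∈ X⁺ and ⟨w*,x⟩ + b* ≤ −1 for every x ∈ X⁻. -/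
open scoped RealInnerProductSpace

theorem inner_sub_sub_nonpos_of_forall_norm_le {F : Type*} [NormedAddCommGroup F]
    [InnerProductSpace ℝ F] {K : Set F} (hK : Convex ℝ K) {u v : F} (hv : v ∈ K)
    (hmin : ∀ w ∈ K, ‖u - v‖ ≤ ‖u - w‖) {w : F} (hw : w ∈ K) :
    ⟪u - v, w - v⟫ ≤ 0 := by
  refine (norm_eq_iInf_iff_real_inner_le_zero hK hv).1 ?_ w hw
  have : Nonempty K := ⟨⟨v, hv⟩⟩
  refine le_antisymm (le_ciInf fun w => hmin w w.2) (ciInf_le ⟨0, ?_⟩ (⟨v, hv⟩ : K))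
  rintro _ ⟨w, rfl⟩
  exact norm_nonneg _

theorem le_norm_sub_of_mem_closure {F : Type*} [SeminormedAddCommGroup F] {A B : Set F} {δ : ℝ}
    (h : ∀ a ∈ A, ∀ b ∈ B, δ ≤ ‖a - b‖) {a b : F} (ha : a ∈ closure A) (hb : b ∈ closure B) :
    δ ≤ ‖a - b‖ := by
  have hab : (a, b) ∈ closure (A ×ˢ B) := by
    rw [closure_prod_eq]
    exact ⟨ha, hb⟩
  have hclosed : IsClosed {p : F × F | δ ≤ ‖p.1 - p.2‖} :=
    isClosed_le continuous_const (by fun_prop)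
  exact closure_minimal (fun p hp => h p.1 hp.1 p.2 hp.2) hclosed hab

theorem stmt_12 {n : ℕ} (Xp Xm : Set (EuclideanSpace ℝ (Fin n)))
    (hXp : Xp.Nonempty) (hXm : Xm.Nonempty)
    (δ : ℝ)
    (hδ : δ = sInf {d : ℝ | ∃ x' ∈ convexHull ℝ Xp, ∃ x'' ∈ convexHull ℝ Xm,
      d = ‖x' - x''‖})
    (hδpos : 0 < δ)
    (xb' xb'' : EuclideanSpace ℝ (Fin n))
    (hxb' : xb' ∈ closure (convexHull ℝ Xp))
    (hxb'' : xb'' ∈ closure (convexHull ℝ Xm))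
    (hdist : ‖xb' - xb''‖ = δ)
    (wstar : EuclideanSpace ℝ (Fin n)) (bstar : ℝ)
    (hw : wstar = (2 / ‖xb' - xb''‖ ^ 2) • (xb' - xb''))
    (hb : bstar = 1 - 2 * ⟪xb' - xb'', xb'⟫ / ‖xb' - xb''‖ ^ 2) :
    (∀ x ∈ Xp, ⟪wstar, x⟫ + bstar ≥ 1) ∧
    (∀ x ∈ Xm, ⟪wstar, x⟫ + bstar ≤ -1) := by
  have hle : ∀ a ∈ convexHull ℝ Xp, ∀ b ∈ convexHull ℝ Xm, δ ≤ ‖a - b‖ := by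
    intro a ha b hb
    rw [hδ]
    refine csInf_le ⟨0, ?_⟩ ⟨a, ha, b, hb, rfl⟩
    rintro _ ⟨x, -, y, -, rfl⟩
    exact norm_nonneg _
  have hD : 0 < ‖xb' - xb''‖ ^ 2 := by rw [hdist]; positivity
  have hDinner : ⟪xb' - xb'', xb'⟫ - ⟪xb' - xb'', xb''⟫ = ‖xb' - xb''‖ ^ 2 := by
    rw [← inner_sub_right, real_inner_self_eq_norm_sq]
  have hval : ∀ x, ⟪wstar, x⟫ + bstar =
      1 + 2 * (⟪xb' - xb'', x⟫ - ⟪xb' - xb'', xb'⟫) / ‖xb' - xb''‖ ^ 2 := by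
    intro x
    rw [hw, hb, real_inner_smul_left]
    ring
  refine ⟨fun x hx => ?_, fun x hx => ?_⟩
  · have h := inner_sub_sub_nonpos_of_forall_norm_le (convex_convexHull ℝ Xp).closure hxb'
      (u := xb'') (fun w hw => by
        rw [norm_sub_rev, hdist, norm_sub_rev]
        exact le_norm_sub_of_mem_closure hle hw hxb'')
      (subset_closure (subset_convexHull ℝ Xp hx))
    rw [← neg_sub xb' xb'', inner_neg_left, inner_sub_right] at h
    rw [hval, ge_iff_le, le_add_iff_nonneg_right]
    exact div_nonneg (by linarith) hD.le
  · have h := inner_sub_sub_nonpos_of_forall_norm_le (convex_convexHull ℝ Xm).closure hxb''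
      (u := xb') (fun w hw => by
        rw [hdist]
        exact le_norm_sub_of_mem_closure hle hxb' hw)
      (subset_closure (subset_convexHull ℝ Xm hx))
    rw [inner_sub_right] at h
    have hdiv : 2 * (⟪xb' - xb'', x⟫ - ⟪xb' - xb'', xb'⟫) / ‖xb' - xb''‖ ^ 2 ≤ -2 := by
      rw [div_le_iff₀ hD]
      linarith
    rw [hval]
    linarith
end

section
/- Let A ⊆ ℝⁿ and let Q ∈ ℝ^{m×n} be η-inner-product-preserving over A. Then for every x̄ ∈ cl(co(A)) and every x ∈ A, |⟨Qx̄,Qx⟩ − ⟨x̄,x⟩| ≤ η; that is, the inner-product distortion bound extends from A to the closed convex hull of A in the first argument. -/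
open scoped RealInnerProductSpace

theorem stmt_14 {n m : ℕ} (A : Set (EuclideanSpace ℝ (Fin n)))
    (Q : EuclideanSpace ℝ (Fin n) →ₗ[ℝ] EuclideanSpace ℝ (Fin m))
    (η : ℝ)
    (hQ : ∀ x ∈ A, ∀ x' ∈ A, |⟪Q x, Q x'⟫ - ⟪x, x'⟫| ≤ η) :
    ∀ xb ∈ closure (convexHull ℝ A), ∀ x ∈ A,
      |⟪Q xb, Q x⟫ - ⟪xb, x⟫| ≤ η := by
  intro xb hxb x hx
  let f : EuclideanSpace ℝ (Fin n) →ₗ[ℝ] ℝ :=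
    (innerₗ (EuclideanSpace ℝ (Fin m)) (Q x)).comp Q - innerₗ (EuclideanSpace ℝ (Fin n)) x
  have hf (y : EuclideanSpace ℝ (Fin n)) : f y = ⟪Q y, Q x⟫ - ⟪y, x⟫ := by
    simp [f, real_inner_comm]
  have hsub : A ⊆ f ⁻¹' Set.Icc (-η) η := fun y hy => by
    rw [Set.mem_preimage, Set.mem_Icc, ← abs_le, hf]
    exact hQ y hy x hx
  have hmem : xb ∈ f ⁻¹' Set.Icc (-η) η :=
    closure_minimal (convexHull_min hsub ((convex_Icc (-η) η).linear_preimage f))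
      (isClosed_Icc.preimage f.continuous_of_finiteDimensional) hxb
  rwa [Set.mem_preimage, Set.mem_Icc, ← abs_le, hf] at hmem
end

section
/- Let X⁺ and X⁻ be nonempty subsets of ℝⁿ, set X := X⁺ ∪ X⁻, and let Q ∈ ℝ^{m×n} be η-inner-product-preserving over X. Let x̄' ∈ cl(co(X⁺)) and x̄'' ∈ cl(co(X⁻)) with x̄' ≠ x̄'', and define w* := 2(x̄' − x̄'')/‖x̄' − x̄''‖². Then w* is ‖w*‖²-compatible with X under Q, i.e. |⟨Qw*,Qx⟩ − ⟨w*,x⟩| ≤ η‖w*‖² for all x ∈ X. -/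
open scoped RealInnerProductSpace

/-- A bound on a continuous linear functional over a set extends to its closed convex hull. -/
theorem abs_le_of_mem_closure_convexHull {E : Type*} [AddCommGroup E] [Module ℝ E]
    [TopologicalSpace E] (f : E →L[ℝ] ℝ) {A : Set E} {c : ℝ} (hA : ∀ a ∈ A, |f a| ≤ c)
    {y : E} (hy : y ∈ closure (convexHull ℝ A)) : |f y| ≤ c := by
  have hclosed : IsClosed {z | |f z| ≤ c} := isClosed_le f.continuous.abs continuous_const
  have hconv : Convex ℝ {z | |f z| ≤ c} := by
    have h := (convex_Icc (-c) c).linear_preimage f.toLinearMap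
    convert h using 1
    ext z
    simp [abs_le]
  exact closure_minimal (convexHull_min hA hconv) hclosed hy

/-- The inner product distortion of `Q` against a fixed vector `x`, as a functional. -/
noncomputable def innerDistortion {E F : Type*} [NormedAddCommGroup E] [InnerProductSpace ℝ E]
    [FiniteDimensional ℝ E] [NormedAddCommGroup F] [InnerProductSpace ℝ F]
    (Q : E →ₗ[ℝ] F) (x : E) : E →L[ℝ] ℝ :=
  (innerSL ℝ (Q x)).comp (LinearMap.toContinuousLinearMap Q) - innerSL ℝ x

theorem innerDistortion_apply {E F : Type*} [NormedAddCommGroup E] [InnerProductSpace ℝ E]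
    [FiniteDimensional ℝ E] [NormedAddCommGroup F] [InnerProductSpace ℝ F]
    (Q : E →ₗ[ℝ] F) (x y : E) : innerDistortion Q x y = ⟪Q y, Q x⟫ - ⟪y, x⟫ := by
  simp [innerDistortion, real_inner_comm]

theorem stmt_15 {n m : ℕ} (Xp Xm : Set (EuclideanSpace ℝ (Fin n)))
    (hXp : Xp.Nonempty) (hXm : Xm.Nonempty)
    (X : Set (EuclideanSpace ℝ (Fin n))) (hX : X = Xp ∪ Xm)
    (Q : EuclideanSpace ℝ (Fin n) →ₗ[ℝ] EuclideanSpace ℝ (Fin m))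
    (η : ℝ)
    (hQ : ∀ x ∈ X, ∀ x' ∈ X, |⟪Q x, Q x'⟫ - ⟪x, x'⟫| ≤ η)
    (xb' xb'' : EuclideanSpace ℝ (Fin n))
    (hxb' : xb' ∈ closure (convexHull ℝ Xp))
    (hxb'' : xb'' ∈ closure (convexHull ℝ Xm))
    (hne : xb' ≠ xb'')
    (wstar : EuclideanSpace ℝ (Fin n))
    (hw : wstar = (2 / ‖xb' - xb''‖ ^ 2) • (xb' - xb'')) :
    ∀ x ∈ X, |⟪Q wstar, Q x⟫ - ⟪wstar, x⟫| ≤ η * ‖wstar‖ ^ 2 := by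
  intro x hx
  have hbound {A : Set (EuclideanSpace ℝ (Fin n))} (hA : A ⊆ X) {y : EuclideanSpace ℝ (Fin n)}
      (hy : y ∈ closure (convexHull ℝ A)) : |innerDistortion Q x y| ≤ η :=
    abs_le_of_mem_closure_convexHull _
      (fun a ha => by simpa only [innerDistortion_apply] using hQ a (hA ha) x hx) hy
  have hp := hbound (hX ▸ Set.subset_union_left) hxb'
  have hm := hbound (hX ▸ Set.subset_union_right) hxb''
  have hd : 0 < ‖xb' - xb''‖ := norm_pos_iff.mpr (sub_ne_zero.mpr hne)
  have hsub : |innerDistortion Q x (xb' - xb'')| ≤ 2 * η := by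
    rw [map_sub]
    linarith [abs_sub (innerDistortion Q x xb') (innerDistortion Q x xb'')]
  rw [← innerDistortion_apply, hw, map_smul, smul_eq_mul, abs_mul, norm_smul, Real.norm_eq_abs,
    abs_of_pos (by positivity : 0 < 2 / ‖xb' - xb''‖ ^ 2)]
  calc 2 / ‖xb' - xb''‖ ^ 2 * |innerDistortion Q x (xb' - xb'')|
      ≤ 2 / ‖xb' - xb''‖ ^ 2 * (2 * η) := by gcongr
    _ = η * (2 / ‖xb' - xb''‖ ^ 2 * ‖xb' - xb''‖) ^ 2 := by
      field_simp
end
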